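/- For each s ∈ S there exists a unique k-algebra homomorphism ν_s : 𝒟 → 𝒟 satisfying ν_s(D_{i0}) = 𝒢⁻¹·((𝒢 − Λ)·D_{i0} − x) and ν_s(D_l) = D_l for all l ∈ S; moreover the endomorphisms ν_{i0} and ν_s (s ∈ S) of 𝒟 pairwise commute. -/

import Mathlib

/-!
The diffusion algebra of type `C` on `N` generators over a field `k`, with
`I = {i0}` and `S = {1,…,N} \ {i0}`, and common coefficient `G` (denoted `𝒢`
in the paper).  It is the quotient of the free associative unital `k`-algebra
on generators `D_1, …, D_N` by the two-sided ideal generated by the elements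
`G·D_{i0}·D_s − (G − Λ)·D_s·D_{i0} + x·D_s` for `s ∈ S` and
`D_s·D_l − D_l·D_s` for `s, l ∈ S`.
-/

noncomputable section

namespace DiffusionC

open FreeAlgebra

variable (k : Type*) [Field k] (N : ℕ) (i0 : Fin N) (Λ x G : k)

/-- The defining relations of the type `C` diffusion algebra. -/
def rel : FreeAlgebra k (Fin N) → FreeAlgebra k (Fin N) → Prop := fun a b =>
  (∃ s : Fin N, s ≠ i0 ∧
      a = G • (ι k i0 * ι k s) ∧
      b = (G - Λ) • (ι k s * ι k i0) - x • ι k s) ∨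
  (∃ s l : Fin N, s ≠ i0 ∧ l ≠ i0 ∧
      a = ι k s * ι k l ∧ b = ι k l * ι k s)

/-- The diffusion algebra `𝒟` of type `C`. -/
abbrev Diff := RingQuot (rel k N i0 Λ x G)

/-- The images of the generators `D_i` in `𝒟`. -/
def D (i : Fin N) : Diff k N i0 Λ x G :=
  RingQuot.mkAlgHom k (rel k N i0 Λ x G) (ι k i)

/-- The defining property of the endomorphism `ν_{i0}` of `𝒟`:
`ν_{i0}(D_{i0}) = D_{i0}` and `ν_{i0}(D_s) = 𝒢·(𝒢 − Λ)⁻¹·D_s` for `s ∈ S`. -/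
def IsNuI0 (ν : Diff k N i0 Λ x G →ₐ[k] Diff k N i0 Λ x G) : Prop :=
  ν (D k N i0 Λ x G i0) = D k N i0 Λ x G i0 ∧
  ∀ s : Fin N, s ≠ i0 →
    ν (D k N i0 Λ x G s) = (G * (G - Λ)⁻¹) • D k N i0 Λ x G s

/-- The defining property of the endomorphism `ν_s` of `𝒟` (`s ∈ S`):
`ν_s(D_{i0}) = 𝒢⁻¹·((𝒢 − Λ)·D_{i0} − x)` and `ν_s(D_l) = D_l` for `l ∈ S`. -/
def IsNuS (s : Fin N) (ν : Diff k N i0 Λ x G →ₐ[k] Diff k N i0 Λ x G) : Prop :=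
  ν (D k N i0 Λ x G i0) = G⁻¹ • ((G - Λ) • D k N i0 Λ x G i0 - x • 1) ∧
  ∀ l : Fin N, l ≠ i0 → ν (D k N i0 Λ x G l) = D k N i0 Λ x G l

theorem hom_ext_D {ν μ : Diff k N i0 Λ x G →ₐ[k] Diff k N i0 Λ x G}
    (h : ∀ i, ν (D k N i0 Λ x G i) = μ (D k N i0 Λ x G i)) : ν = μ := by
  apply RingQuot.ringQuot_ext'
  apply FreeAlgebra.hom_ext
  funext i
  exact h i

theorem D_rel (s : Fin N) (hs : s ≠ i0) :
    G • (D k N i0 Λ x G i0 * D k N i0 Λ x G s) =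
      (G - Λ) • (D k N i0 Λ x G s * D k N i0 Λ x G i0) - x • D k N i0 Λ x G s := by
  have h := RingQuot.mkAlgHom_rel k (s := rel k N i0 Λ x G) (Or.inl ⟨s, hs, rfl, rfl⟩)
  simpa only [D, map_smul, map_mul, map_sub] using h

theorem D_comm (s l : Fin N) (hs : s ≠ i0) (hl : l ≠ i0) :
    D k N i0 Λ x G s * D k N i0 Λ x G l = D k N i0 Λ x G l * D k N i0 Λ x G s := by
  have h := RingQuot.mkAlgHom_rel k (s := rel k N i0 Λ x G) (Or.inr ⟨s, l, hs, hl, rfl, rfl⟩)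
  simpa only [D, map_mul] using h

theorem exists_nuS (hG0 : G ≠ 0) (s : Fin N) : ∃ ν, IsNuS k N i0 Λ x G s ν := by
  classical
  let f : Fin N → Diff k N i0 Λ x G := fun i =>
    if i = i0 then G⁻¹ • ((G - Λ) • D k N i0 Λ x G i0 - x • 1) else D k N i0 Λ x G i
  have f0 : f i0 = G⁻¹ • ((G - Λ) • D k N i0 Λ x G i0 - x • 1) := if_pos rfl
  have f1 : ∀ l, l ≠ i0 → f l = D k N i0 Λ x G l := fun l hl => if_neg hl
  have key : ∀ ⦃a b⦄, rel k N i0 Λ x G a b →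
      FreeAlgebra.lift k f a = FreeAlgebra.lift k f b := by
    rintro a b (⟨t, ht, rfl, rfl⟩ | ⟨t, l, ht, hl, rfl, rfl⟩)
    · simp only [map_smul, map_mul, map_sub, FreeAlgebra.lift_ι_apply, f0, f1 t ht]
      have h := D_rel k N i0 Λ x G t ht
      rw [smul_mul_assoc, smul_inv_smul₀ hG0, sub_mul, smul_mul_assoc, smul_mul_assoc, one_mul,
        mul_smul_comm, mul_sub, mul_smul_comm, mul_smul_comm, mul_one, ← h,
        inv_smul_smul₀ hG0]
    · simp only [map_mul, FreeAlgebra.lift_ι_apply, f1 t ht, f1 l hl]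
      exact D_comm k N i0 Λ x G t l ht hl
  have hv : ∀ i, RingQuot.liftAlgHom k ⟨FreeAlgebra.lift k f, key⟩ (D k N i0 Λ x G i) = f i := by
    intro i
    rw [D, RingQuot.liftAlgHom_mkAlgHom_apply, FreeAlgebra.lift_ι_apply]
  exact ⟨RingQuot.liftAlgHom k ⟨FreeAlgebra.lift k f, key⟩, (hv i0).trans f0,
    fun l hl => (hv l).trans (f1 l hl)⟩

theorem nuS_unique (s l : Fin N) {ν μ} (h : IsNuS k N i0 Λ x G s ν)
    (h' : IsNuS k N i0 Λ x G l μ) : ν = μ := by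
  apply hom_ext_D
  intro i
  by_cases hi : i = i0
  · subst hi; rw [h.1, h'.1]
  · rw [h.2 i hi, h'.2 i hi]

/-- For each `s ∈ S` there exists a unique `k`-algebra
homomorphism `ν_s : 𝒟 → 𝒟` with `ν_s(D_{i0}) = 𝒢⁻¹·((𝒢 − Λ)·D_{i0} − x)` and
`ν_s(D_l) = D_l` for all `l ∈ S`; moreover the endomorphisms `ν_{i0}` and `ν_s`
(`s ∈ S`) pairwise commute. -/
theorem existsUnique_nuS_and_commute (hN : 3 ≤ N) (hG0 : G ≠ 0) (hGΛ : G ≠ Λ) :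
    (∀ s : Fin N, s ≠ i0 →
      ∃! ν : Diff k N i0 Λ x G →ₐ[k] Diff k N i0 Λ x G,
        IsNuS k N i0 Λ x G s ν) ∧
    (∀ ν0, IsNuI0 k N i0 Λ x G ν0 →
      ∀ s : Fin N, s ≠ i0 → ∀ νs, IsNuS k N i0 Λ x G s νs →
        ν0.comp νs = νs.comp ν0) ∧
    (∀ s l : Fin N, s ≠ i0 → l ≠ i0 →
      ∀ νs νl, IsNuS k N i0 Λ x G s νs → IsNuS k N i0 Λ x G l νl →
        νs.comp νl = νl.comp νs) := by
  refine ⟨fun s _ => ?_, ?_, ?_⟩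
  · obtain ⟨ν, h⟩ := exists_nuS k N i0 Λ x G hG0 s
    exact ⟨ν, h, fun μ hμ => nuS_unique k N i0 Λ x G s s hμ h⟩
  · intro ν0 h0 s _ νs h
    apply hom_ext_D
    intro i
    by_cases hi : i = i0
    · subst hi
      simp only [AlgHom.comp_apply, h.1, h0.1, map_smul, map_sub, map_one]
    · simp only [AlgHom.comp_apply, h.2 i hi, h0.2 i hi, map_smul]
  · intro s l _ _ νs νl hs hl
    rw [nuS_unique k N i0 Λ x G s l hs hl]

end DiffusionC
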